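/- arXiv:2305.05605 — 2 statements merged into one kernel-verified Lean document; each statement's English description precedes it below -/
import Mathlib

section
/- Let α, β, γ, δ ∈ (0, π/2] and let M be the 5×5 real symmetric tridiagonal matrix with all diagonal entries 1, sub/super-diagonal entries M(0,1)=-cos α, M(1,2)=-cos β, M(2,3)=-cos γ, M(3,4)=-cos δ (and symmetrically), and all other entries 0. Then M is positive definite if and only if cos²β/sin²α + cos²γ/sin²δ < 1. -/
open Real

namespace Matrix

/-- Completing squares in the quadratic form of a unit-diagonal tridiagonal matrix of size five,
working from both ends towards the middle variable. -/
theorem dotProduct_tridiagonal_mulVec {a s b c d t : ℝ} (hs : s ≠ 0) (ht : t ≠ 0)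
    (has : s ^ 2 + a ^ 2 = 1) (hdt : t ^ 2 + d ^ 2 = 1) (x : Fin 5 → ℝ) :
    x ⬝ᵥ (!![1, -a, 0, 0, 0;
             -a, 1, -b, 0, 0;
             0, -b, 1, -c, 0;
             0, 0, -c, 1, -d;
             0, 0, 0, -d, 1] *ᵥ x) =
      (x 0 - a * x 1) ^ 2 + (s * x 1 - b / s * x 2) ^ 2
        + (1 - (b ^ 2 / s ^ 2 + c ^ 2 / t ^ 2)) * x 2 ^ 2
        + (t * x 3 - c / t * x 2) ^ 2 + (x 4 - d * x 3) ^ 2 := by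
  have hb : s * (b / s) = b := mul_div_cancel₀ b hs
  have hc : t * (c / t) = c := mul_div_cancel₀ c ht
  simp only [dotProduct, mulVec, Fin.sum_univ_five, of_apply, cons_val]
  rw [← div_pow, ← div_pow]
  linear_combination (-x 1 ^ 2) * has - x 3 ^ 2 * hdt + 2 * x 1 * x 2 * hb + 2 * x 2 * x 3 * hc

theorem posDef_tridiagonal_iff {a s b c d t : ℝ} (hs : s ≠ 0) (ht : t ≠ 0)
    (has : s ^ 2 + a ^ 2 = 1) (hdt : t ^ 2 + d ^ 2 = 1) :
    (!![1, -a, 0, 0, 0;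
        -a, 1, -b, 0, 0;
        0, -b, 1, -c, 0;
        0, 0, -c, 1, -d;
        0, 0, 0, -d, 1] : Matrix (Fin 5) (Fin 5) ℝ).PosDef ↔
      b ^ 2 / s ^ 2 + c ^ 2 / t ^ 2 < 1 := by
  constructor
  · intro h
    let x : Fin 5 → ℝ := ![a * (b / s ^ 2), b / s ^ 2, 1, c / t ^ 2, d * (c / t ^ 2)]
    have hx : x ≠ 0 := fun h0 => one_ne_zero (congrFun h0 2)
    have key := h.dotProduct_mulVec_pos hx
    rw [star_trivial, dotProduct_tridiagonal_mulVec hs ht has hdt] at key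
    have hb : s * (b / s ^ 2) = b / s := by field_simp
    have hc : t * (c / t ^ 2) = c / t := by field_simp
    simpa [x, hb, hc] using key
  · intro h
    refine PosDef.of_dotProduct_mulVec_pos ?_ fun x hx => ?_
    · ext i j
      fin_cases i <;> fin_cases j <;> simp
    rw [star_trivial, dotProduct_tridiagonal_mulVec hs ht has hdt]
    by_contra! hle
    have hpos : 0 < 1 - (b ^ 2 / s ^ 2 + c ^ 2 / t ^ 2) := sub_pos.mpr h
    have h01 := sq_nonneg (x 0 - a * x 1)
    have h12 := sq_nonneg (s * x 1 - b / s * x 2)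
    have h2 := mul_nonneg hpos.le (sq_nonneg (x 2))
    have h32 := sq_nonneg (t * x 3 - c / t * x 2)
    have h43 := sq_nonneg (x 4 - d * x 3)
    have x2 : x 2 = 0 := by
      have : (1 - (b ^ 2 / s ^ 2 + c ^ 2 / t ^ 2)) * x 2 ^ 2 = 0 := by linarith
      simpa [hpos.ne'] using this
    have x1 : x 1 = 0 := by
      have : (s * x 1 - b / s * x 2) ^ 2 = 0 := by linarith
      simpa [x2, hs] using this
    have x3 : x 3 = 0 := by
      have : (t * x 3 - c / t * x 2) ^ 2 = 0 := by linarith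
      simpa [x2, ht] using this
    have x0 : x 0 = 0 := by
      have : (x 0 - a * x 1) ^ 2 = 0 := by linarith
      simpa [x1] using this
    have x4 : x 4 = 0 := by
      have : (x 4 - d * x 3) ^ 2 = 0 := by linarith
      simpa [x3] using this
    refine hx (funext fun i => ?_)
    fin_cases i <;> assumption

end Matrix

theorem stmt2 (α β γ δ : ℝ)
    (hα : α ∈ Set.Ioc 0 (Real.pi / 2)) (hβ : β ∈ Set.Ioc 0 (Real.pi / 2))
    (hγ : γ ∈ Set.Ioc 0 (Real.pi / 2)) (hδ : δ ∈ Set.Ioc 0 (Real.pi / 2))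
    (M : Matrix (Fin 5) (Fin 5) ℝ)
    (hM : M = !![1, -Real.cos α, 0, 0, 0;
                 -Real.cos α, 1, -Real.cos β, 0, 0;
                 0, -Real.cos β, 1, -Real.cos γ, 0;
                 0, 0, -Real.cos γ, 1, -Real.cos δ;
                 0, 0, 0, -Real.cos δ, 1]) :
    M.PosDef ↔
      Real.cos β ^ 2 / Real.sin α ^ 2 + Real.cos γ ^ 2 / Real.sin δ ^ 2 < 1 := by
  have sin_ne : ∀ θ ∈ Set.Ioc 0 (Real.pi / 2), Real.sin θ ≠ 0 := fun θ hθ =>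
    (Real.sin_pos_of_pos_of_lt_pi hθ.1 (hθ.2.trans_lt (half_lt_self Real.pi_pos))).ne'
  rw [hM]
  exact Matrix.posDef_tridiagonal_iff (sin_ne α hα) (sin_ne δ hδ)
    (Real.sin_sq_add_cos_sq α) (Real.sin_sq_add_cos_sq δ)
end

section
/- Let α, β, γ, δ ∈ (0, π/2] and let M be the 5×5 real symmetric tridiagonal matrix with all diagonal entries 1, sub/super-diagonal entries M(0,1)=-cos α, M(1,2)=-cos β, M(2,3)=-cos γ, M(3,4)=-cos δ (and symmetrically), and all other entries 0. Then M is positive semidefinite if and only if cos²β/sin²α + cos²γ/sin²δ ≤ 1. -/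
open Real

/-- Completing squares from both ends of the quadratic form of a symmetric tridiagonal `5 × 5`
matrix with unit diagonal. -/
theorem tridiagonal_five_form_eq {a b c d s t : ℝ} (hs : s ≠ 0) (ht : t ≠ 0)
    (has : a ^ 2 = 1 - s) (hdt : d ^ 2 = 1 - t) (x : Fin 5 → ℝ) :
    star x ⬝ᵥ (!![1, -a, 0, 0, 0;
                  -a, 1, -b, 0, 0;
                  0, -b, 1, -c, 0;
                  0, 0, -c, 1, -d;
                  0, 0, 0, -d, 1].mulVec x) =
      (x 0 - a * x 1) ^ 2 + (x 4 - d * x 3) ^ 2 + s * (x 1 - b / s * x 2) ^ 2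
        + t * (x 3 - c / t * x 2) ^ 2 + (1 - (b ^ 2 / s + c ^ 2 / t)) * x 2 ^ 2 := by
  simp only [dotProduct, Matrix.mulVec, Fin.sum_univ_five, Matrix.of_apply, Matrix.cons_val,
    Pi.star_apply, star_trivial]
  field_simp
  linear_combination (-(s * t * x 1 ^ 2)) * has - s * t * x 3 ^ 2 * hdt

theorem tridiagonal_five_posSemidef_iff {a b c d s t : ℝ} (hs : 0 < s) (ht : 0 < t)
    (has : a ^ 2 = 1 - s) (hdt : d ^ 2 = 1 - t) :
    (!![1, -a, 0, 0, 0;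
        -a, 1, -b, 0, 0;
        0, -b, 1, -c, 0;
        0, 0, -c, 1, -d;
        0, 0, 0, -d, 1] : Matrix (Fin 5) (Fin 5) ℝ).PosSemidef ↔
      b ^ 2 / s + c ^ 2 / t ≤ 1 := by
  rw [Matrix.posSemidef_iff_dotProduct_mulVec]
  simp only [tridiagonal_five_form_eq hs.ne' ht.ne' has hdt]
  constructor
  · rintro ⟨-, h⟩
    simpa using h ![a * (b / s), b / s, 1, c / t, d * (c / t)]
  · intro h
    refine ⟨?_, fun x => ?_⟩
    · ext i j
      fin_cases i <;> fin_cases j <;> simp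
    · have := sub_nonneg.mpr h
      positivity

theorem stmt3 (α β γ δ : ℝ)
    (hα : α ∈ Set.Ioc 0 (Real.pi / 2)) (hβ : β ∈ Set.Ioc 0 (Real.pi / 2))
    (hγ : γ ∈ Set.Ioc 0 (Real.pi / 2)) (hδ : δ ∈ Set.Ioc 0 (Real.pi / 2))
    (M : Matrix (Fin 5) (Fin 5) ℝ)
    (hM : M = !![1, -Real.cos α, 0, 0, 0;
                 -Real.cos α, 1, -Real.cos β, 0, 0;
                 0, -Real.cos β, 1, -Real.cos γ, 0;
                 0, 0, -Real.cos γ, 1, -Real.cos δ;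
                 0, 0, 0, -Real.cos δ, 1]) :
    M.PosSemidef ↔
      Real.cos β ^ 2 / Real.sin α ^ 2 + Real.cos γ ^ 2 / Real.sin δ ^ 2 ≤ 1 := by
  have sin_pos {θ : ℝ} (hθ : θ ∈ Set.Ioc 0 (Real.pi / 2)) : 0 < Real.sin θ :=
    Real.sin_pos_of_pos_of_lt_pi hθ.1 (by linarith [hθ.2, Real.pi_pos])
  rw [hM]
  exact tridiagonal_five_posSemidef_iff (pow_pos (sin_pos hα) 2) (pow_pos (sin_pos hδ) 2)
    (Real.cos_sq' α) (Real.cos_sq' δ)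
end
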